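/- For every f ∈ C(Ω), the hyperinterpolation error satisfies ‖f − L_n f‖_{L²(μ)} ≤ 2 √(μ(Ω)) · E_n(f, Ω), where E_n(f, Ω) = inf_{p ∈ P_n(Ω)} ‖f − p‖_∞. In particular, L_n f → f in L²(μ) whenever E_n(f, Ω) → 0 as n → ∞. -/

import Mathlib

open MeasureTheory

/-- The hyperinterpolation operator `L_n f = Σ_j ⟨f, p_j⟩_M p_j`, where
`⟨f, g⟩_M = Σ_i w_i f(x_i) g(x_i)`. -/
noncomputable def hyperinterpolant {d M N : ℕ} (p : Fin N → MvPolynomial (Fin d) ℝ)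
    (x : Fin M → (Fin d → ℝ)) (w : Fin M → ℝ) (f : (Fin d → ℝ) → ℝ) :
    (Fin d → ℝ) → ℝ :=
  fun y => ∑ j, (∑ i, w i * f (x i) * MvPolynomial.eval (x i) (p j)) *
    MvPolynomial.eval y (p j)

/-- The uniform norm `‖f‖_∞ = sup_{t ∈ Ω} |f t|` of a function on a set `Ω`. -/
noncomputable def uniformNormOn {d : ℕ} (Ω : Set (Fin d → ℝ)) (f : (Fin d → ℝ) → ℝ) : ℝ :=
  sSup ((fun t => |f t|) '' Ω)

/-- The best uniform polynomial approximation error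
`E_n(f, Ω) = inf_{p ∈ P_n(Ω)} ‖f − p‖_∞`. -/
noncomputable def bestApproxErr {d : ℕ} (n : ℕ) (Ω : Set (Fin d → ℝ))
    (f : (Fin d → ℝ) → ℝ) : ℝ :=
  sInf {e : ℝ | ∃ q : MvPolynomial (Fin d) ℝ, q.totalDegree ≤ n ∧
    e = uniformNormOn Ω (fun t => f t - MvPolynomial.eval t q)}

lemma hyperinterpolant_sub {d M N : ℕ} (p : Fin N → MvPolynomial (Fin d) ℝ)
    (x : Fin M → (Fin d → ℝ)) (w : Fin M → ℝ) (f g : (Fin d → ℝ) → ℝ) (t : Fin d → ℝ) :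
    hyperinterpolant p x w (fun s => f s - g s) t =
      hyperinterpolant p x w f t - hyperinterpolant p x w g t := by
  simp only [hyperinterpolant, mul_sub, sub_mul, Finset.sum_sub_distrib]

/-- Hyperinterpolation reproduces linear combinations of a discretely orthonormal family. -/
lemma hyperinterpolant_of_eq_sum {d M N : ℕ} {p : Fin N → MvPolynomial (Fin d) ℝ}
    {x : Fin M → (Fin d → ℝ)} {w : Fin M → ℝ}
    (horth : ∀ j k, ∑ i, w i * (MvPolynomial.eval (x i) (p j) * MvPolynomial.eval (x i) (p k)) =
      if j = k then 1 else 0)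
    {g : (Fin d → ℝ) → ℝ} {a : Fin N → ℝ}
    (hg : ∀ i, g (x i) = ∑ j, a j * MvPolynomial.eval (x i) (p j)) (t : Fin d → ℝ) :
    hyperinterpolant p x w g t = ∑ j, a j * MvPolynomial.eval t (p j) := by
  refine Finset.sum_congr rfl fun j _ => ?_
  congr 1
  calc ∑ i, w i * g (x i) * MvPolynomial.eval (x i) (p j)
      = ∑ i, ∑ k, a k *
          (w i * (MvPolynomial.eval (x i) (p k) * MvPolynomial.eval (x i) (p j))) := by
        refine Finset.sum_congr rfl fun i _ => ?_
        rw [hg, Finset.mul_sum, Finset.sum_mul]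
        exact Finset.sum_congr rfl fun k _ => by ring
    _ = a j := by
        rw [Finset.sum_comm]
        simp [← Finset.mul_sum, horth]

lemma continuous_hyperinterpolant {d M N : ℕ} (p : Fin N → MvPolynomial (Fin d) ℝ)
    (x : Fin M → (Fin d → ℝ)) (w : Fin M → ℝ) (f : (Fin d → ℝ) → ℝ) :
    Continuous (hyperinterpolant p x w f) :=
  continuous_finsetSum _ fun j _ => continuous_const.mul (MvPolynomial.continuous_eval (p j))

/-- Bessel's inequality for a family orthonormal in a weighted discrete inner product. -/
lemma sum_sq_coeff_le {ι κ : Type*} [Fintype ι] [Fintype κ] [DecidableEq κ]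
    {w : ι → ℝ} (hw : ∀ i, 0 ≤ w i) {P : κ → ι → ℝ}
    (horth : ∀ j k, ∑ i, w i * (P j i * P k i) = if j = k then 1 else 0) (g : ι → ℝ) :
    ∑ j, (∑ i, w i * g i * P j i) ^ 2 ≤ ∑ i, w i * g i ^ 2 := by
  set c : κ → ℝ := fun j => ∑ i, w i * g i * P j i with hc
  have h₀ : 0 ≤ ∑ i, w i * (g i - ∑ j, c j * P j i) ^ 2 :=
    Finset.sum_nonneg fun i _ => mul_nonneg (hw i) (sq_nonneg _)
  have h₁ : ∑ i, w i * g i * ∑ j, c j * P j i = ∑ j, c j ^ 2 := by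
    simp_rw [Finset.mul_sum]
    rw [Finset.sum_comm]
    refine Finset.sum_congr rfl fun j _ => ?_
    rw [sq]
    nth_rewrite 3 [hc]
    rw [Finset.mul_sum]
    exact Finset.sum_congr rfl fun i _ => by ring
  have h₂ : ∑ i, w i * (∑ j, c j * P j i) ^ 2 = ∑ j, c j ^ 2 := by
    calc ∑ i, w i * (∑ j, c j * P j i) ^ 2
        = ∑ i, ∑ j, ∑ k, c j * c k * (w i * (P j i * P k i)) := by
          refine Finset.sum_congr rfl fun i _ => ?_
          rw [sq, Finset.sum_mul_sum, Finset.mul_sum]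
          refine Finset.sum_congr rfl fun j _ => ?_
          rw [Finset.mul_sum]
          exact Finset.sum_congr rfl fun k _ => by ring
      _ = ∑ j, ∑ k, c j * c k * ∑ i, w i * (P j i * P k i) := by
          rw [Finset.sum_comm]
          refine Finset.sum_congr rfl fun j _ => ?_
          rw [Finset.sum_comm]
          exact Finset.sum_congr rfl fun k _ => (Finset.mul_sum _ _ _).symm
      _ = ∑ j, c j ^ 2 := by simp [horth, sq]
  have h₃ : ∑ i, w i * (g i - ∑ j, c j * P j i) ^ 2 =
      ∑ i, w i * g i ^ 2 - 2 * ∑ i, w i * g i * ∑ j, c j * P j i +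
        ∑ i, w i * (∑ j, c j * P j i) ^ 2 := by
    rw [Finset.mul_sum, ← Finset.sum_sub_distrib, ← Finset.sum_add_distrib]
    exact Finset.sum_congr rfl fun i _ => by ring
  linarith

/-- The squared `L²` norm of a linear combination of an orthonormal family of polynomials. -/
lemma setIntegral_sq_sum_eval {d N : ℕ} {Ω : Set (Fin d → ℝ)} (hΩ : IsCompact Ω)
    {μ : Measure (Fin d → ℝ)} [IsFiniteMeasure μ] {p : Fin N → MvPolynomial (Fin d) ℝ}
    (horth : ∀ j k, (∫ t in Ω, MvPolynomial.eval t (p j) * MvPolynomial.eval t (p k) ∂μ) =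
      if j = k then 1 else 0) (c : Fin N → ℝ) :
    ∫ t in Ω, (∑ j, c j * MvPolynomial.eval t (p j)) ^ 2 ∂μ = ∑ j, c j ^ 2 := by
  have hint : ∀ j k, IntegrableOn
      (fun t => c j * c k * (MvPolynomial.eval t (p j) * MvPolynomial.eval t (p k))) Ω μ :=
    fun j k => (continuous_const.mul ((MvPolynomial.continuous_eval (p j)).mul
      (MvPolynomial.continuous_eval (p k)))).continuousOn.integrableOn_compact hΩ
  have hexp : ∀ t : Fin d → ℝ, (∑ j, c j * MvPolynomial.eval t (p j)) ^ 2 =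
      ∑ j, ∑ k, c j * c k * (MvPolynomial.eval t (p j) * MvPolynomial.eval t (p k)) := by
    intro t
    rw [sq, Finset.sum_mul_sum]
    exact Finset.sum_congr rfl fun j _ => Finset.sum_congr rfl fun k _ => by ring
  simp_rw [hexp]
  rw [integral_finsetSum _ fun j _ => integrable_finsetSum _ fun k _ => hint j k]
  refine Finset.sum_congr rfl fun j _ => ?_
  rw [integral_finsetSum _ fun k _ => hint j k]
  simp [integral_const_mul, horth, sq]

lemma abs_le_uniformNormOn {d : ℕ} {Ω : Set (Fin d → ℝ)} (hΩ : IsCompact Ω)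
    {g : (Fin d → ℝ) → ℝ} (hg : ContinuousOn g Ω) {t : Fin d → ℝ} (ht : t ∈ Ω) :
    |g t| ≤ uniformNormOn Ω g :=
  le_csSup (hΩ.image_of_continuousOn hg.abs).bddAbove ⟨t, ht, rfl⟩

/-- The hyperinterpolation error bound
`‖f − L_n f‖_{L²(μ)} ≤ 2 √(μ(Ω)) · E_n(f, Ω)`. -/
theorem hyperinterpolation_L2_error_bound
    (d n M N : ℕ)
    (Ω : Set (Fin d → ℝ)) (hΩc : IsCompact Ω) (hΩne : Ω.Nonempty)
    (μ : Measure (Fin d → ℝ)) (hfin : IsFiniteMeasure μ) (hsupp : μ Ωᶜ = 0)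
    (p : Fin N → MvPolynomial (Fin d) ℝ)
    (hpdeg : ∀ j, (p j).totalDegree ≤ n)
    (horth : ∀ j k, (∫ t in Ω, MvPolynomial.eval t (p j) * MvPolynomial.eval t (p k) ∂μ) =
      if j = k then 1 else 0)
    (hspan : ∀ q : MvPolynomial (Fin d) ℝ, q.totalDegree ≤ n →
      ∃ a : Fin N → ℝ, ∀ t ∈ Ω,
        MvPolynomial.eval t q = ∑ j, a j * MvPolynomial.eval t (p j))
    (x : Fin M → (Fin d → ℝ)) (hx : ∀ i, x i ∈ Ω)
    (w : Fin M → ℝ) (hw : ∀ i, 0 < w i)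
    (hcub : ∀ q : MvPolynomial (Fin d) ℝ, q.totalDegree ≤ 2 * n →
      ∑ i, w i * MvPolynomial.eval (x i) q = ∫ t in Ω, MvPolynomial.eval t q ∂μ)
    (f : (Fin d → ℝ) → ℝ) (hf : ContinuousOn f Ω) :
    Real.sqrt (∫ t in Ω, (f t - hyperinterpolant p x w f t) ^ 2 ∂μ) ≤
      2 * Real.sqrt ((μ Ω).toReal) * bestApproxErr n Ω f := by
  have hdisc : ∀ j k, ∑ i, w i *
      (MvPolynomial.eval (x i) (p j) * MvPolynomial.eval (x i) (p k)) =
        if j = k then 1 else 0 := by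
    intro j k
    have hdeg : (p j * p k).totalDegree ≤ 2 * n :=
      (MvPolynomial.totalDegree_mul _ _).trans (by linarith [hpdeg j, hpdeg k])
    simpa only [map_mul, horth] using hcub _ hdeg
  have hwsum : ∑ i, w i = (μ Ω).toReal := by
    simpa [Measure.real] using hcub 1 (by simp)
  rw [bestApproxErr, ← smul_eq_mul, ← Real.sInf_smul_of_nonneg (by positivity)]
  refine le_csInf (Set.Nonempty.smul_set ⟨_, 0, by simp, rfl⟩) ?_
  rintro _ ⟨_, ⟨q, hq, rfl⟩, rfl⟩
  set g : (Fin d → ℝ) → ℝ := fun t => f t - MvPolynomial.eval t q with hg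
  set e := uniformNormOn Ω g
  have hgc : ContinuousOn g Ω := hf.sub (MvPolynomial.continuous_eval q).continuousOn
  have hge : ∀ t ∈ Ω, |g t| ≤ e := fun t ht => abs_le_uniformNormOn hΩc hgc ht
  have he : 0 ≤ e := (abs_nonneg _).trans (hge _ hΩne.some_mem)
  have hgsq : ∀ t ∈ Ω, g t ^ 2 ≤ e ^ 2 := fun t ht => sq_le_sq' (abs_le.1 (hge t ht)).1
    (abs_le.1 (hge t ht)).2
  obtain ⟨a, ha⟩ := hspan q hq
  have herr : ∀ t ∈ Ω, f t - hyperinterpolant p x w f t =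
      g t - hyperinterpolant p x w g t := by
    intro t ht
    have hLq := hyperinterpolant_of_eq_sum hdisc (g := fun s => MvPolynomial.eval s q)
      (fun i => ha _ (hx i)) t
    rw [hg, hyperinterpolant_sub, hLq, ← ha t ht]
    ring
  have hLc := continuous_hyperinterpolant p x w g
  have hL : ∫ t in Ω, hyperinterpolant p x w g t ^ 2 ∂μ ≤ e ^ 2 * (μ Ω).toReal := by
    calc ∫ t in Ω, hyperinterpolant p x w g t ^ 2 ∂μ
        = ∑ j, (∑ i, w i * g (x i) * MvPolynomial.eval (x i) (p j)) ^ 2 :=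
          setIntegral_sq_sum_eval hΩc horth _
      _ ≤ ∑ i, w i * g (x i) ^ 2 := sum_sq_coeff_le (fun i => (hw i).le) hdisc _
      _ ≤ ∑ i, w i * e ^ 2 := Finset.sum_le_sum fun i _ =>
          mul_le_mul_of_nonneg_left (hgsq _ (hx i)) (hw i).le
      _ = e ^ 2 * (μ Ω).toReal := by rw [← Finset.sum_mul, hwsum, mul_comm]
  have hLi : IntegrableOn (fun t => hyperinterpolant p x w g t ^ 2) Ω μ :=
    (hLc.pow 2).continuousOn.integrableOn_compact hΩc
  have hbound : ∫ t in Ω, (f t - hyperinterpolant p x w f t) ^ 2 ∂μ ≤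
      4 * (e ^ 2 * (μ Ω).toReal) := by
    calc ∫ t in Ω, (f t - hyperinterpolant p x w f t) ^ 2 ∂μ
        = ∫ t in Ω, (g t - hyperinterpolant p x w g t) ^ 2 ∂μ :=
          setIntegral_congr_fun hΩc.measurableSet fun t ht => by simp only [herr t ht]
      _ ≤ ∫ t in Ω, (2 * e ^ 2 + 2 * hyperinterpolant p x w g t ^ 2) ∂μ := by
          refine setIntegral_mono_on
            (((hgc.sub hLc.continuousOn).pow 2).integrableOn_compact hΩc)
            ((integrable_const _).add (hLi.const_mul 2)) hΩc.measurableSet fun t ht => ?_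
          nlinarith [hgsq t ht, sq_nonneg (g t + hyperinterpolant p x w g t)]
      _ = 2 * (e ^ 2 * (μ Ω).toReal) + 2 * ∫ t in Ω, hyperinterpolant p x w g t ^ 2 ∂μ := by
          rw [integral_add (integrable_const _) (hLi.const_mul 2), setIntegral_const,
            integral_const_mul, smul_eq_mul, Measure.real]
          ring
      _ ≤ 4 * (e ^ 2 * (μ Ω).toReal) := by linarith
  refine Real.sqrt_le_iff.2 ⟨by simp only [smul_eq_mul]; positivity, hbound.trans_eq ?_⟩
  simp only [smul_eq_mul, mul_pow, Real.sq_sqrt ENNReal.toReal_nonneg]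
  ring
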